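/- Let d ≥ 2 and m ≥ 2 be integers, and let Ω_jit be the jittered partition of [0,1]^d into the m^d congruent axis-aligned closed cubes of side length 1/m. Then the stratified sample from Ω_jit does not minimize the mean squared L2-discrepancy among stratified samples from convex equivolume partitions of [0,1]^d into m^d sets: there exists a convex equivolume partition Ω̃ of [0,1]^d into m^d sets with E L2²(P_Ω̃) < E L2²(P_Ω_jit). -/

import Mathlib

open MeasureTheory ProbabilityTheory

noncomputable section

namespace StratifiedSampling

variable {d : ℕ} {ι : Type} [Fintype ι]

/-- Lebesgue volume of a subset of `ℝ^d` as a real number. -/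
def vol (s : Set (Fin d → ℝ)) : ℝ := (volume s).toReal

/-- Number of points of the configuration `p` that lie in the lower box `(-∞, x]`. -/
def countIn (p : ι → (Fin d → ℝ)) (x : Fin d → ℝ) : ℝ :=
  ∑ i, Set.indicator (Set.Iic x) (fun _ => (1 : ℝ)) (p i)

/-- Discrepancy function of the point configuration `p` in the set `K`:
`d_P(x) = #(P ∩ (-∞,x])/N − |K ∩ (-∞,x]|/|K|`. -/
def discrep (K : Set (Fin d → ℝ)) (p : ι → (Fin d → ℝ)) (x : Fin d → ℝ) : ℝ :=
  countIn p x / (Fintype.card ι : ℝ) - vol (K ∩ Set.Iic x) / vol K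

/-- Joint distribution of the stratified sample associated with the family `Ω`:
the points are independent and the `i`-th point is uniformly distributed on `Ω i`. -/
def stratDist (Ω : ι → Set (Fin d → ℝ)) : Measure (ι → (Fin d → ℝ)) :=
  Measure.pi fun i => ProbabilityTheory.cond volume (Ω i)

/-- Mean squared `L2`-discrepancy of the stratified sample from the family `Ω` in `K`:
`E L2²(P_Ω) = E[(1/|K|) ∫_K d_{P_Ω}(x)² dx]`. -/
def meanL2sq (K : Set (Fin d → ℝ)) (Ω : ι → Set (Fin d → ℝ)) : ℝ :=
  ∫ p, ((1 / vol K) * ∫ x in K, (discrep K p x) ^ 2) ∂(stratDist Ω)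

/-- `Ω` is a partition of `K`: measurable sets of positive volume whose union
is `K` and whose distinct members have disjoint interiors. -/
structure IsPartition (K : Set (Fin d → ℝ)) (Ω : ι → Set (Fin d → ℝ)) : Prop where
  measurableSet : ∀ i, MeasurableSet (Ω i)
  vol_pos : ∀ i, 0 < volume (Ω i)
  iUnion_eq : (⋃ i, Ω i) = K
  disjoint_interiors : ∀ i j, i ≠ j → interior (Ω i) ∩ interior (Ω j) = ∅

/-- All members of `Ω` have the same volume. -/
def IsEquivolume (Ω : ι → Set (Fin d → ℝ)) : Prop :=
  ∀ i j, volume (Ω i) = volume (Ω j)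

/-- `q_i(x) = |Ω_i ∩ (-∞,x]| / |Ω_i|`. -/
def qfun (Ω : ι → Set (Fin d → ℝ)) (i : ι) (x : Fin d → ℝ) : ℝ :=
  vol (Ω i ∩ Set.Iic x) / vol (Ω i)

end StratifiedSampling

namespace StratifiedSampling

/-- The jittered cube with multi-index `j`: the axis-aligned closed cube
`∏_k [j_k/m, (j_k+1)/m]` of side length `1/m`. -/
def jitteredCube {d : ℕ} (m : ℕ) (j : Fin d → Fin m) : Set (Fin d → ℝ) :=
  Set.Icc (fun k => (j k : ℝ) / m) (fun k => ((j k : ℝ) + 1) / m)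

theorem integral_sq_countIn_sub {d : ℕ} {ι : Type} [Fintype ι] (μ : ι → Measure (Fin d → ℝ))
    [∀ i, IsProbabilityMeasure (μ i)] (x : Fin d → ℝ) (N c : ℝ) :
    ∫ p, (countIn p x / N - c) ^ 2 ∂(Measure.pi μ) =
      (∑ i, ((μ i).real (Set.Iic x) - (μ i).real (Set.Iic x) ^ 2)) / N ^ 2 +
        ((∑ i, (μ i).real (Set.Iic x)) / N - c) ^ 2 := by
  set f : (Fin d → ℝ) → ℝ := Set.indicator (Set.Iic x) (fun _ => (1 : ℝ)) with hf
  have hfm : Measurable f := measurable_const.indicator measurableSet_Iic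
  have hfL : ∀ i, MemLp f 2 (μ i) := fun i =>
    (memLp_const (1 : ℝ)).indicator measurableSet_Iic
  have hcm : MemLp (fun p : ι → Fin d → ℝ => countIn p x) 2 (Measure.pi μ) := by
    unfold countIn
    exact memLp_finsetSum _ fun i _ =>
      (hfL i).comp_measurePreserving (measurePreserving_eval μ i)
  have hint : ∀ i, ∫ y, f y ∂(μ i) = (μ i).real (Set.Iic x) := fun i => by
    exact integral_indicator_one measurableSet_Iic
  have hmean : ∫ p, countIn p x ∂(Measure.pi μ) = ∑ i, (μ i).real (Set.Iic x) := by
    unfold countIn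
    rw [integral_finsetSum]
    · refine Finset.sum_congr rfl fun i _ => ?_
      rw [← hint i]
      exact integral_comp_eval (μ := μ) (i := i) hfm.aestronglyMeasurable
    · intro i _
      exact (((hfL i).comp_measurePreserving (measurePreserving_eval μ i)).integrable
        (by norm_num))
  have hvar : variance (fun p : ι → Fin d → ℝ => countIn p x) (Measure.pi μ) =
      ∑ i, ((μ i).real (Set.Iic x) - (μ i).real (Set.Iic x) ^ 2) := by
    have := variance_sum_pi (μ := μ) (X := fun _ => f) hfL
    have h2 : (fun p : ι → Fin d → ℝ => countIn p x) = ∑ i, fun p : ι → Fin d → ℝ => f (p i) := by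
      ext p; simp [countIn, hf]
    rw [h2, this]
    refine Finset.sum_congr rfl fun i _ => ?_
    rw [variance_eq_sub (hfL i), hint i]
    congr 1
    rw [← hint i]
    refine integral_congr_ae (Filter.Eventually.of_forall fun y => ?_)
    simp only [hf, Pi.pow_apply, Set.indicator]
    split_ifs <;> simp
  have hI : Integrable (fun p : ι → Fin d → ℝ => countIn p x) (Measure.pi μ) :=
    hcm.integrable (by norm_num)
  have hv := variance_eq_sub hcm
  have hI2 : Integrable (fun p : ι → Fin d → ℝ => countIn p x ^ 2) (Measure.pi μ) :=
    hcm.integrable_sq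
  have hexp : ∀ p : ι → Fin d → ℝ, (countIn p x / N - c) ^ 2 =
      (1 / N ^ 2) * countIn p x ^ 2 - (2 * c / N) * countIn p x + c ^ 2 := fun p => by ring
  have hI' : Integrable (fun p : ι → Fin d → ℝ => (2 * c / N) * countIn p x) (Measure.pi μ) :=
    hI.const_mul _
  have hI2' : Integrable (fun p : ι → Fin d → ℝ => (1 / N ^ 2) * countIn p x ^ 2)
      (Measure.pi μ) := hI2.const_mul _
  have hdiff : Integrable (fun p : ι → Fin d → ℝ =>
      (1 / N ^ 2) * countIn p x ^ 2 - (2 * c / N) * countIn p x) (Measure.pi μ) := hI2'.sub hI'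
  simp_rw [hexp]
  rw [integral_add hdiff (integrable_const _), integral_sub hI2' hI', integral_const_mul,
    integral_const_mul]
  rw [hvar, hmean] at hv
  simp only [Pi.pow_apply] at hv
  rw [← sub_eq_iff_eq_add.1 hv.symm |>.symm, hmean]
  simp
  ring

theorem measurable_vol_inter_Iic {d : ℕ} {S : Set (Fin d → ℝ)} (hS : MeasurableSet S) :
    Measurable fun x => vol (S ∩ Set.Iic x) := by
  have h : MeasurableSet {q : (Fin d → ℝ) × (Fin d → ℝ) | q.2 ∈ S ∧ q.2 ≤ q.1} :=
    (measurable_snd hS).inter (measurableSet_le measurable_snd measurable_fst)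
  exact (measurable_measure_prodMk_left (ν := volume) h).ennreal_toReal

theorem measurable_qfun {d : ℕ} {ι : Type} [Fintype ι] {Ω : ι → Set (Fin d → ℝ)}
    (hΩ : ∀ i, MeasurableSet (Ω i)) (i : ι) : Measurable (qfun Ω i) :=
  (measurable_vol_inter_Iic (hΩ i)).div_const _

theorem qfun_nonneg {d : ℕ} {ι : Type} [Fintype ι] (Ω : ι → Set (Fin d → ℝ)) (i : ι)
    (x : Fin d → ℝ) : 0 ≤ qfun Ω i x :=
  div_nonneg ENNReal.toReal_nonneg ENNReal.toReal_nonneg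

theorem vol_inter_Iic_div_le_one {d : ℕ} (S : Set (Fin d → ℝ)) (hS : volume S ≠ ⊤)
    (x : Fin d → ℝ) : vol (S ∩ Set.Iic x) / vol S ≤ 1 :=
  div_le_one_of_le₀ (ENNReal.toReal_mono hS (measure_mono Set.inter_subset_left))
    ENNReal.toReal_nonneg

theorem countIn_nonneg {d : ℕ} {ι : Type} [Fintype ι] (p : ι → Fin d → ℝ) (x : Fin d → ℝ) :
    0 ≤ countIn p x :=
  Finset.sum_nonneg fun _ _ => Set.indicator_nonneg (fun _ _ => zero_le_one) _

theorem countIn_le_card {d : ℕ} {ι : Type} [Fintype ι] (p : ι → Fin d → ℝ) (x : Fin d → ℝ) :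
    countIn p x ≤ Fintype.card ι := by
  refine (Finset.sum_le_card_nsmul _ _ 1 fun i _ => ?_).trans (by simp)
  exact Set.indicator_le_self' (fun _ _ => zero_le_one) _

theorem sq_discrep_le_one {d : ℕ} {ι : Type} [Fintype ι] {K : Set (Fin d → ℝ)}
    (hK : volume K ≠ ⊤) (p : ι → Fin d → ℝ) (x : Fin d → ℝ) : discrep K p x ^ 2 ≤ 1 := by
  have h1 : 0 ≤ countIn p x / (Fintype.card ι : ℝ) :=
    div_nonneg (countIn_nonneg p x) (Nat.cast_nonneg _)
  have h2 : countIn p x / (Fintype.card ι : ℝ) ≤ 1 :=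
    div_le_one_of_le₀ (countIn_le_card p x) (Nat.cast_nonneg _)
  have h3 : 0 ≤ vol (K ∩ Set.Iic x) / vol K :=
    div_nonneg ENNReal.toReal_nonneg ENNReal.toReal_nonneg
  have h4 := vol_inter_Iic_div_le_one K hK x
  rw [sq_le_one_iff_abs_le_one, abs_le, discrep]
  constructor <;> linarith

theorem measurable_discrep {d : ℕ} {ι : Type} [Fintype ι] {K : Set (Fin d → ℝ)}
    (hK : MeasurableSet K) :
    Measurable fun q : (ι → Fin d → ℝ) × (Fin d → ℝ) => discrep K q.1 q.2 := by
  refine Measurable.sub (Measurable.div_const ?_ _) (Measurable.div_const ?_ _)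
  · refine Finset.measurable_sum _ fun i _ => ?_
    have h : MeasurableSet {q : (ι → Fin d → ℝ) × (Fin d → ℝ) | q.1 i ≤ q.2} :=
      measurableSet_le ((measurable_pi_apply i).comp measurable_fst) measurable_snd
    exact (measurable_const (a := (1 : ℝ))).indicator h
  · exact (measurable_vol_inter_Iic hK).comp measurable_snd

theorem meanL2sq_eq_setIntegral {d : ℕ} {ι : Type} [Fintype ι] {K : Set (Fin d → ℝ)}
    (hK : MeasurableSet K) (hKfin : volume K ≠ ⊤) {Ω : ι → Set (Fin d → ℝ)}
    (hpos : ∀ i, volume (Ω i) ≠ 0) (hfin : ∀ i, volume (Ω i) ≠ ⊤)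
    (hΩ : ∀ i, MeasurableSet (Ω i)) :
    meanL2sq K Ω = (1 / vol K) * ∫ x in K,
      ((∑ i, (qfun Ω i x - qfun Ω i x ^ 2)) / (Fintype.card ι : ℝ) ^ 2 +
        ((∑ i, qfun Ω i x) / (Fintype.card ι : ℝ) - vol (K ∩ Set.Iic x) / vol K) ^ 2) := by
  have : ∀ i, IsProbabilityMeasure (ProbabilityTheory.cond volume (Ω i)) := fun i =>
    cond_isProbabilityMeasure_of_finite (hpos i) (hfin i)
  have : IsFiniteMeasure (volume.restrict K) := ⟨by simpa using hKfin.lt_top⟩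
  have hint : Integrable (fun q : (ι → Fin d → ℝ) × (Fin d → ℝ) => discrep K q.1 q.2 ^ 2)
      ((Measure.pi fun i => ProbabilityTheory.cond volume (Ω i)).prod (volume.restrict K)) := by
    refine Integrable.of_bound ((measurable_discrep hK).pow_const 2).aestronglyMeasurable 1
      (Filter.Eventually.of_forall fun q => ?_)
    rw [Real.norm_of_nonneg (sq_nonneg _)]
    exact sq_discrep_le_one hKfin _ _
  have hq : ∀ i x, (ProbabilityTheory.cond volume (Ω i)).real (Set.Iic x) = qfun Ω i x := by
    intro i x
    rw [Measure.real, cond_apply (hΩ i), ENNReal.toReal_mul, ENNReal.toReal_inv, qfun, vol, vol,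
      div_eq_inv_mul]
  rw [meanL2sq, stratDist, integral_const_mul, integral_integral_swap hint]
  simp_rw [discrep, integral_sq_countIn_sub, hq]

/-- Redistributing the mass of two cells decreases the mean squared discrepancy as soon as it
increases the integral of `q_a ^ 2 + q_b ^ 2`. -/
theorem meanL2sq_lt_of_two_cells {d : ℕ} {ι : Type} [Fintype ι] {K : Set (Fin d → ℝ)}
    (hK : MeasurableSet K) (hKpos : volume K ≠ 0) (hKfin : volume K ≠ ⊤)
    {Ω Ω' : ι → Set (Fin d → ℝ)}
    (hpos : ∀ i, volume (Ω i) ≠ 0) (hfin : ∀ i, volume (Ω i) ≠ ⊤)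
    (hΩ : ∀ i, MeasurableSet (Ω i))
    (hpos' : ∀ i, volume (Ω' i) ≠ 0) (hfin' : ∀ i, volume (Ω' i) ≠ ⊤)
    (hΩ' : ∀ i, MeasurableSet (Ω' i)) {a b : ι} (hab : a ≠ b)
    (hagree : ∀ i, i ≠ a → i ≠ b → Ω' i = Ω i)
    (hsum : ∀ x, qfun Ω' a x + qfun Ω' b x = qfun Ω a x + qfun Ω b x)
    (hlt : ∫ x in K, (qfun Ω a x ^ 2 + qfun Ω b x ^ 2) <
      ∫ x in K, (qfun Ω' a x ^ 2 + qfun Ω' b x ^ 2)) :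
    meanL2sq K Ω' < meanL2sq K Ω := by
  classical
  have : IsFiniteMeasure (volume.restrict K) := ⟨by simpa using hKfin.lt_top⟩
  have hsplit : ∀ f : ι → ℝ, ∑ i, f i = f a + f b + ∑ i ∈ (Finset.univ.erase a).erase b, f i := by
    intro f
    rw [← Finset.add_sum_erase _ _ (Finset.mem_univ a), ← Finset.add_sum_erase _ _
      (Finset.mem_erase.2 ⟨hab.symm, Finset.mem_univ b⟩), add_assoc]
  have hrest : ∀ i ∈ (Finset.univ.erase a).erase b, ∀ x, qfun Ω' i x = qfun Ω i x := by
    intro i hi x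
    simp only [Finset.mem_erase, Finset.mem_univ, and_true] at hi
    simp only [qfun, hagree i hi.2 hi.1]
  have hsum' : ∀ x, ∑ i, qfun Ω' i x = ∑ i, qfun Ω i x := fun x => by
    rw [hsplit, hsplit (fun i => qfun Ω i x), hsum,
      Finset.sum_congr rfl fun i hi => hrest i hi x]
  have hq2 : ∀ {Ψ : ι → Set (Fin d → ℝ)}, (∀ i, volume (Ψ i) ≠ ⊤) → (∀ i, MeasurableSet (Ψ i)) →
      ∀ i, Integrable (fun x => qfun Ψ i x ^ 2) (volume.restrict K) := by
    intro Ψ hf hm i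
    refine Integrable.of_bound ((measurable_qfun hm i).pow_const 2).aestronglyMeasurable 1
      (Filter.Eventually.of_forall fun x => ?_)
    rw [Real.norm_of_nonneg (sq_nonneg _)]
    exact pow_le_one₀ (qfun_nonneg _ _ _) (vol_inter_Iic_div_le_one _ (hf i) x)
  have hbias : ∀ {Ψ : ι → Set (Fin d → ℝ)}, (∀ i, volume (Ψ i) ≠ ⊤) →
      (∀ i, MeasurableSet (Ψ i)) → Integrable (fun x => (∑ i, qfun Ψ i x) /
        (Fintype.card ι : ℝ) ^ 2 + ((∑ i, qfun Ψ i x) / (Fintype.card ι : ℝ) -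
          vol (K ∩ Set.Iic x) / vol K) ^ 2) (volume.restrict K) := by
    intro Ψ hf hm
    have hm1 : Measurable fun x => ∑ i, qfun Ψ i x :=
      Finset.measurable_sum _ fun i _ => measurable_qfun hm i
    have h0 : ∀ x, 0 ≤ ∑ i, qfun Ψ i x := fun x =>
      Finset.sum_nonneg fun i _ => qfun_nonneg _ _ _
    have h1 : ∀ x, ∑ i, qfun Ψ i x ≤ Fintype.card ι := fun x => by
      refine (Finset.sum_le_card_nsmul _ _ 1 fun i _ => ?_).trans (by simp)
      exact vol_inter_Iic_div_le_one _ (hf i) x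
    refine Integrable.add ?_ ?_
    · refine Integrable.of_bound (hm1.div_const _).aestronglyMeasurable
        ((Fintype.card ι : ℝ) / (Fintype.card ι : ℝ) ^ 2)
        (Filter.Eventually.of_forall fun x => ?_)
      rw [Real.norm_of_nonneg (div_nonneg (h0 x) (by positivity))]
      exact div_le_div_of_nonneg_right (h1 x) (by positivity)
    · refine Integrable.of_bound (((hm1.div_const _).sub
        ((measurable_vol_inter_Iic hK).div_const _)).pow_const 2).aestronglyMeasurable 1
        (Filter.Eventually.of_forall fun x => ?_)
      rw [Real.norm_of_nonneg (sq_nonneg _), sq_le_one_iff_abs_le_one, abs_le]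
      have h2 : 0 ≤ (∑ i, qfun Ψ i x) / (Fintype.card ι : ℝ) :=
        div_nonneg (h0 x) (Nat.cast_nonneg _)
      have h3 : (∑ i, qfun Ψ i x) / (Fintype.card ι : ℝ) ≤ 1 :=
        div_le_one_of_le₀ (h1 x) (Nat.cast_nonneg _)
      have h4 : 0 ≤ vol (K ∩ Set.Iic x) / vol K :=
        div_nonneg ENNReal.toReal_nonneg ENNReal.toReal_nonneg
      have h5 := vol_inter_Iic_div_le_one K hKfin x
      constructor <;> linarith
  have hform : ∀ {Ψ : ι → Set (Fin d → ℝ)}, (∀ i, volume (Ψ i) ≠ 0) →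
      (∀ i, volume (Ψ i) ≠ ⊤) → (∀ i, MeasurableSet (Ψ i)) →
      meanL2sq K Ψ = (1 / vol K) * ((∫ x in K, ((∑ i, qfun Ψ i x) /
        (Fintype.card ι : ℝ) ^ 2 + ((∑ i, qfun Ψ i x) / (Fintype.card ι : ℝ) -
          vol (K ∩ Set.Iic x) / vol K) ^ 2)) - (1 / (Fintype.card ι : ℝ) ^ 2) *
        ((∫ x in K, (qfun Ψ a x ^ 2 + qfun Ψ b x ^ 2)) +
          ∫ x in K, ∑ i ∈ (Finset.univ.erase a).erase b, qfun Ψ i x ^ 2)) := by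
    intro Ψ hp hf hm
    have hab2 : Integrable (fun x => qfun Ψ a x ^ 2 + qfun Ψ b x ^ 2) (volume.restrict K) :=
      (hq2 hf hm a).add (hq2 hf hm b)
    have hrest2 : Integrable (fun x => ∑ i ∈ (Finset.univ.erase a).erase b, qfun Ψ i x ^ 2)
        (volume.restrict K) := integrable_finsetSum _ fun i _ => hq2 hf hm i
    have hall : Integrable (fun x => (1 / (Fintype.card ι : ℝ) ^ 2) *
        (qfun Ψ a x ^ 2 + qfun Ψ b x ^ 2 +
          ∑ i ∈ (Finset.univ.erase a).erase b, qfun Ψ i x ^ 2)) (volume.restrict K) :=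
      (hab2.add hrest2).const_mul _
    rw [meanL2sq_eq_setIntegral hK hKfin hp hf hm, ← integral_add hab2 hrest2]
    congr 1
    rw [← integral_const_mul, ← integral_sub (hbias hf hm) hall]
    refine integral_congr_ae (Filter.Eventually.of_forall fun x => ?_)
    simp only [Finset.sum_sub_distrib]
    rw [hsplit fun i => qfun Ψ i x ^ 2]
    ring
  rw [hform hpos hfin hΩ, hform hpos' hfin' hΩ']
  simp_rw [hsum']
  have hrest2 : ∀ x, ∑ i ∈ (Finset.univ.erase a).erase b, qfun Ω' i x ^ 2 =
      ∑ i ∈ (Finset.univ.erase a).erase b, qfun Ω i x ^ 2 := fun x =>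
    Finset.sum_congr rfl fun i hi => by rw [hrest i hi x]
  simp_rw [hrest2]
  have hvK : 0 < vol K := ENNReal.toReal_pos hKpos hKfin
  have : Nonempty ι := ⟨a⟩
  have hN : (0 : ℝ) < 1 / (Fintype.card ι : ℝ) ^ 2 := by
    have : (0 : ℝ) < Fintype.card ι := Nat.cast_pos.2 Fintype.card_pos
    positivity
  refine mul_lt_mul_of_pos_left ?_ (by positivity)
  refine sub_lt_sub_left (mul_lt_mul_of_pos_left ?_ hN) _
  linarith

/-- Area of the part of the planar set `S` that lies in the lower quadrant with corner `y`. -/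
def lowerArea (S : Set (ℝ × ℝ)) (y : ℝ × ℝ) : ℝ := volume.real (S ∩ Set.Iic y)

/-- The rectangle of width `2h` and height `h` at the upper right corner of the unit square. -/
def cornerRect (h : ℝ) : Set (ℝ × ℝ) := Set.Icc (1 - 2 * h) 1 ×ˢ Set.Icc (1 - h) 1

/-- The left half of `cornerRect h`. -/
def leftSquare (h : ℝ) : Set (ℝ × ℝ) := Set.Icc (1 - 2 * h) (1 - h) ×ˢ Set.Icc (1 - h) 1

/-- The right half of `cornerRect h`. -/
def rightSquare (h : ℝ) : Set (ℝ × ℝ) := Set.Icc (1 - h) 1 ×ˢ Set.Icc (1 - h) 1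

/-- The part of `cornerRect h` below its decreasing diagonal. -/
def lowerTriangle (h : ℝ) : Set (ℝ × ℝ) := cornerRect h ∩ {z | z.1 + 2 * z.2 ≤ 3 - 2 * h}

/-- The part of `cornerRect h` above its decreasing diagonal. -/
def upperTriangle (h : ℝ) : Set (ℝ × ℝ) := cornerRect h ∩ {z | 3 - 2 * h ≤ z.1 + 2 * z.2}

theorem measurableSet_cornerRect (h : ℝ) : MeasurableSet (cornerRect h) :=
  measurableSet_Icc.prod measurableSet_Icc

theorem measurableSet_rightSquare (h : ℝ) : MeasurableSet (rightSquare h) :=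
  measurableSet_Icc.prod measurableSet_Icc

theorem measurableSet_lowerTriangle (h : ℝ) : MeasurableSet (lowerTriangle h) :=
  (measurableSet_cornerRect h).inter
    (measurableSet_le (measurable_fst.add (measurable_snd.const_mul 2)) measurable_const)

theorem measurableSet_upperTriangle (h : ℝ) : MeasurableSet (upperTriangle h) :=
  (measurableSet_cornerRect h).inter
    (measurableSet_le measurable_const (measurable_fst.add (measurable_snd.const_mul 2)))

theorem convex_cornerRect (h : ℝ) : Convex ℝ (cornerRect h) :=
  (convex_Icc _ _).prod (convex_Icc _ _)

theorem isLinearMap_fst_add_two_mul_snd : IsLinearMap ℝ fun z : ℝ × ℝ => z.1 + 2 * z.2 where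
  map_add x y := by simp; ring
  map_smul c x := by simp; ring

theorem convex_lowerTriangle (h : ℝ) : Convex ℝ (lowerTriangle h) :=
  (convex_cornerRect h).inter (convex_halfSpace_le isLinearMap_fst_add_two_mul_snd _)

theorem convex_upperTriangle (h : ℝ) : Convex ℝ (upperTriangle h) :=
  (convex_cornerRect h).inter (convex_halfSpace_ge isLinearMap_fst_add_two_mul_snd _)

theorem lowerTriangle_union_upperTriangle (h : ℝ) :
    lowerTriangle h ∪ upperTriangle h = cornerRect h := by
  rw [lowerTriangle, upperTriangle, ← Set.inter_union_distrib_left]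
  exact Set.inter_eq_left.2 fun z _ => le_total (z.1 + 2 * z.2) (3 - 2 * h)

theorem leftSquare_union_rightSquare {h : ℝ} (hh : 0 ≤ h) :
    leftSquare h ∪ rightSquare h = cornerRect h := by
  rw [leftSquare, rightSquare, ← Set.union_prod,
    Set.Icc_union_Icc_eq_Icc (by linarith) (by linarith), cornerRect]

theorem aedisjoint_lowerTriangle_upperTriangle (h : ℝ) :
    AEDisjoint volume (lowerTriangle h) (upperTriangle h) := by
  rw [AEDisjoint, Measure.volume_eq_prod, Measure.measure_prod_null
    ((measurableSet_lowerTriangle h).inter (measurableSet_upperTriangle h))]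
  refine Filter.Eventually.of_forall fun u => ?_
  refine measure_mono_null (t := {(3 - 2 * h - u) / 2}) ?_ (by simp)
  rintro w ⟨⟨-, h1⟩, -, h2⟩
  simp only [Set.mem_ofPred_eq] at h1 h2
  simp only [Set.mem_singleton_iff]
  linarith

theorem aedisjoint_leftSquare_rightSquare (h : ℝ) :
    AEDisjoint volume (leftSquare h) (rightSquare h) := by
  refine measure_mono_null (t := {1 - h} ×ˢ Set.univ) ?_ ?_
  · rintro z ⟨⟨h1, -⟩, h2, -⟩
    exact ⟨le_antisymm h1.2 h2.1, trivial⟩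
  · rw [Measure.volume_eq_prod, Measure.prod_prod]
    simp

theorem volume_cornerRect_ne_top (h : ℝ) : volume (cornerRect h) ≠ ⊤ :=
  (isCompact_Icc.prod isCompact_Icc).measure_lt_top.ne

theorem lowerArea_add_lowerArea {S T : Set (ℝ × ℝ)} {h : ℝ} (hT : MeasurableSet T)
    (hST : AEDisjoint volume S T) (hU : S ∪ T = cornerRect h) (y : ℝ × ℝ) :
    lowerArea S y + lowerArea T y = lowerArea (cornerRect h) y := by
  have hfin : ∀ X ⊆ cornerRect h, volume (X ∩ Set.Iic y) ≠ ⊤ := fun X hX =>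
    ne_top_of_le_ne_top (volume_cornerRect_ne_top h)
      (measure_mono (Set.inter_subset_left.trans hX))
  rw [lowerArea, lowerArea, lowerArea, ← hU, Set.union_inter_distrib_right, Measure.real,
    Measure.real, Measure.real, measure_union₀ (hT.inter measurableSet_Iic).nullMeasurableSet
    (hST.mono Set.inter_subset_left Set.inter_subset_left),
    ENNReal.toReal_add (hfin S (hU ▸ Set.subset_union_left))
      (hfin T (hU ▸ Set.subset_union_right))]

theorem lowerArea_eq_zero {S : Set (ℝ × ℝ)} {h : ℝ} (hS : S ⊆ cornerRect h) {y : ℝ × ℝ}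
    (hy : y ≤ 1) (hy' : y ∉ cornerRect h) : lowerArea S y = 0 := by
  have : S ∩ Set.Iic y = ∅ := by
    refine Set.eq_empty_of_forall_notMem fun z ⟨hz, hzy⟩ => hy' ?_
    obtain ⟨h1, h2⟩ := hS hz
    exact ⟨⟨h1.1.trans hzy.1, hy.1⟩, ⟨h2.1.trans hzy.2, hy.2⟩⟩
  simp [lowerArea, this]

theorem lowerArea_Icc_prod_Icc (a b c d : ℝ) (y : ℝ × ℝ) :
    lowerArea (Set.Icc a b ×ˢ Set.Icc c d) y =
      max (min b y.1 - a) 0 * max (min d y.2 - c) 0 := by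
  have hIcc : ∀ p q r : ℝ, volume.real (Set.Icc p q ∩ Set.Iic r) = max (min q r - p) 0 := by
    intro p q r
    rw [← Set.Ici_inter_Iic, Set.inter_assoc, Set.Iic_inter_Iic, Set.Ici_inter_Iic,
      Measure.real, Real.volume_Icc, ENNReal.toReal_ofReal']
  rw [lowerArea, ← Prod.mk.eta (p := y), ← Set.Iic_prod_Iic, Set.prod_inter_prod,
    Measure.volume_eq_prod, measureReal_prod_prod, hIcc, hIcc]

theorem lowerArea_cornerRect {h : ℝ} {y : ℝ × ℝ} (hy : y ∈ cornerRect h) :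
    lowerArea (cornerRect h) y = (y.1 - (1 - 2 * h)) * (y.2 - (1 - h)) := by
  obtain ⟨h1, h2⟩ := hy
  rw [cornerRect, lowerArea_Icc_prod_Icc, min_eq_right h1.2, min_eq_right h2.2,
    max_eq_left (by linarith [h1.1]), max_eq_left (by linarith [h2.1])]

theorem lowerArea_rightSquare {h : ℝ} {y : ℝ × ℝ} (hy : y ∈ cornerRect h) :
    lowerArea (rightSquare h) y = max (y.1 - (1 - h)) 0 * (y.2 - (1 - h)) := by
  obtain ⟨h1, h2⟩ := hy
  rw [rightSquare, lowerArea_Icc_prod_Icc, min_eq_right h1.2, min_eq_right h2.2,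
    max_eq_left (a := y.2 - (1 - h)) (by linarith [h2.1])]

theorem intervalIntegral_max_sub {g : ℝ → ℝ} (hg : Continuous g) (hg0 : g 0 = 0) {a b c : ℝ}
    (hac : a ≤ c) (hab : a ≤ b) :
    ∫ t in a..b, g (max (t - c) 0) = ∫ s in (0 : ℝ)..max (b - c) 0, g s := by
  have hzero : ∀ r, a ≤ r → r ≤ c → ∫ t in a..r, g (max (t - c) 0) = 0 := fun r har hr => by
    rw [intervalIntegral.integral_congr (g := fun _ => 0), intervalIntegral.integral_zero]
    intro t ht
    rw [Set.uIcc_of_le har] at ht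
    change g (max (t - c) 0) = 0
    rw [max_eq_right (by linarith [ht.2]), hg0]
  have hcont : Continuous fun t => g (max (t - c) 0) := by fun_prop
  rcases le_total b c with hbc | hcb
  · rw [hzero b hab hbc, max_eq_right (by linarith), intervalIntegral.integral_same]
  · rw [← intervalIntegral.integral_add_adjacent_intervals (hcont.intervalIntegrable a c)
      (hcont.intervalIntegrable c b), hzero c hac le_rfl, zero_add, max_eq_left (by linarith),
      ← sub_self c, ← intervalIntegral.integral_comp_sub_right]
    refine intervalIntegral.integral_congr fun t ht => ?_
    rw [Set.uIcc_of_le hcb] at ht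
    rw [max_eq_left (by linarith [ht.1])]

theorem lowerArea_upperTriangle {h : ℝ} {y : ℝ × ℝ} (hy : y ∈ cornerRect h) :
    lowerArea (upperTriangle h) y = max (y.2 - (1 - h) - (h - (y.1 - (1 - 2 * h)) / 2)) 0 ^ 2 := by
  obtain ⟨h1, h2⟩ := hy
  have hslice : ∀ u, volume (Prod.mk u ⁻¹' (upperTriangle h ∩ Set.Iic y)) =
      (Set.Icc (1 - 2 * h) y.1).indicator
        (fun t => ENNReal.ofReal (max (t - (3 - 2 * h - 2 * y.2)) 0 / 2)) u := by
    intro u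
    by_cases hu : u ∈ Set.Icc (1 - 2 * h) y.1
    · have hu1 : u ≤ 1 := hu.2.trans h1.2
      have : Prod.mk u ⁻¹' (upperTriangle h ∩ Set.Iic y) =
          Set.Icc ((3 - 2 * h - u) / 2) y.2 := by
        ext w
        simp only [upperTriangle, cornerRect, Set.mem_preimage, Set.mem_inter_iff, Set.mem_prod,
          Set.mem_Icc, Set.mem_ofPred_eq, Set.mem_Iic, Prod.le_def]
        constructor
        · rintro ⟨⟨-, h3⟩, -, h4⟩
          exact ⟨by linarith, h4⟩
        · rintro ⟨h3, h4⟩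
          exact ⟨⟨⟨⟨hu.1, hu1⟩, by linarith, h4.trans h2.2⟩, by linarith⟩, hu.2, h4⟩
      rw [this, Set.indicator_of_mem hu, Real.volume_Icc,
        show y.2 - (3 - 2 * h - u) / 2 = (u - (3 - 2 * h - 2 * y.2)) / 2 by ring]
      rcases le_total (u - (3 - 2 * h - 2 * y.2)) 0 with hs | hs
      · rw [max_eq_right hs, zero_div, ENNReal.ofReal_zero, ENNReal.ofReal_eq_zero]
        linarith
      · rw [max_eq_left hs]
    · have : Prod.mk u ⁻¹' (upperTriangle h ∩ Set.Iic y) = ∅ := by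
        refine Set.eq_empty_of_forall_notMem fun w hw => hu ?_
        exact ⟨hw.1.1.1.1, hw.2.1⟩
      rw [this, measure_empty, Set.indicator_of_notMem hu]
  have hcont : Continuous fun t : ℝ => max (t - (3 - 2 * h - 2 * y.2)) 0 / 2 := by fun_prop
  rw [lowerArea, Measure.real, Measure.volume_eq_prod, Measure.prod_apply
    ((measurableSet_upperTriangle h).inter measurableSet_Iic), lintegral_congr hslice,
    lintegral_indicator measurableSet_Icc, ← ofReal_integral_eq_lintegral_ofReal
      hcont.integrableOn_Icc (Filter.Eventually.of_forall fun t => by positivity),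
    ENNReal.toReal_ofReal (integral_nonneg fun t => by positivity),
    integral_Icc_eq_integral_Ioc, ← intervalIntegral.integral_of_le h1.1,
    intervalIntegral_max_sub (g := fun s => s / 2) (by fun_prop) (by simp)
      (by linarith [h2.2]) h1.1, intervalIntegral.integral_div, integral_id]
  have : y.1 - (3 - 2 * h - 2 * y.2) =
      2 * (y.2 - (1 - h) - (h - (y.1 - (1 - 2 * h)) / 2)) := by ring
  rw [this, ← mul_zero (2 : ℝ), ← mul_max_of_nonneg _ _ (by norm_num : (0 : ℝ) ≤ 2), mul_zero]
  ring

theorem setIntegral_cornerRect {f : ℝ × ℝ → ℝ} (hf : Continuous f) {h : ℝ} (hh : 0 ≤ h) :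
    ∫ y in cornerRect h, f y =
      ∫ u in (0 : ℝ)..2 * h, ∫ w in (0 : ℝ)..h, f (u + (1 - 2 * h), w + (1 - h)) := by
  rw [cornerRect, Measure.volume_eq_prod, setIntegral_prod _
    (hf.continuousOn.integrableOn_compact (isCompact_Icc.prod isCompact_Icc)),
    integral_Icc_eq_integral_Ioc, ← intervalIntegral.integral_of_le (by linarith),
    intervalIntegral.integral_comp_add_right
      (fun u => ∫ w in (0 : ℝ)..h, f (u, w + (1 - h))) (1 - 2 * h)]
  rw [zero_add, show 2 * h + (1 - 2 * h) = 1 by ring]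
  refine intervalIntegral.integral_congr fun u _ => ?_
  rw [integral_Icc_eq_integral_Ioc, ← intervalIntegral.integral_of_le (by linarith),
    intervalIntegral.integral_comp_add_right (fun w => f (u, w)) (1 - h), zero_add,
    show h + (1 - h) = 1 by ring]

theorem setIntegral_rightSquare_term {h : ℝ} (hh : 0 ≤ h) :
    ∫ y in cornerRect h, max (y.1 - (1 - h)) 0 * (y.2 - (1 - h)) *
      ((y.1 - (1 - 2 * h)) * (y.2 - (1 - h)) - max (y.1 - (1 - h)) 0 * (y.2 - (1 - h))) =
      h ^ 6 / 6 := by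
  rw [setIntegral_cornerRect (by fun_prop) hh]
  have hinner : ∀ u : ℝ, ∫ w in (0 : ℝ)..h,
      max (u + (1 - 2 * h) - (1 - h)) 0 * (w + (1 - h) - (1 - h)) *
        ((u + (1 - 2 * h) - (1 - 2 * h)) * (w + (1 - h) - (1 - h)) -
          max (u + (1 - 2 * h) - (1 - h)) 0 * (w + (1 - h) - (1 - h))) =
      max (u - h) 0 * (h ^ 4 / 3) := by
    intro u
    have h1 : ∀ w : ℝ, max (u + (1 - 2 * h) - (1 - h)) 0 * (w + (1 - h) - (1 - h)) *
        ((u + (1 - 2 * h) - (1 - 2 * h)) * (w + (1 - h) - (1 - h)) -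
          max (u + (1 - 2 * h) - (1 - h)) 0 * (w + (1 - h) - (1 - h))) =
        max (u - h) 0 * h * w ^ 2 := by
      intro w
      rw [show u + (1 - 2 * h) - (1 - h) = u - h by ring]
      rcases le_total (u - h) 0 with hu | hu
      · rw [max_eq_right hu]; ring
      · rw [max_eq_left hu]; ring
    simp_rw [h1]
    rw [intervalIntegral.integral_const_mul, integral_pow]
    norm_num
    ring
  simp_rw [hinner]
  rw [intervalIntegral_max_sub (g := fun s => s * (h ^ 4 / 3)) (by fun_prop) (by simp) hh
    (by linarith), intervalIntegral.integral_mul_const, integral_id, max_eq_left (by linarith)]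
  ring

theorem setIntegral_upperTriangle_term {h : ℝ} (hh : 0 ≤ h) :
    ∫ y in cornerRect h, max (y.2 - (1 - h) - (h - (y.1 - (1 - 2 * h)) / 2)) 0 ^ 2 *
      ((y.1 - (1 - 2 * h)) * (y.2 - (1 - h)) -
        max (y.2 - (1 - h) - (h - (y.1 - (1 - 2 * h)) / 2)) 0 ^ 2) =
      13 / 90 * h ^ 6 := by
  rw [setIntegral_cornerRect (by fun_prop) hh]
  have hinner : ∀ u ∈ Set.uIcc 0 (2 * h), ∫ w in (0 : ℝ)..h,
      max (w + (1 - h) - (1 - h) - (h - (u + (1 - 2 * h) - (1 - 2 * h)) / 2)) 0 ^ 2 *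
        ((u + (1 - 2 * h) - (1 - 2 * h)) * (w + (1 - h) - (1 - h)) -
          max (w + (1 - h) - (1 - h) - (h - (u + (1 - 2 * h) - (1 - 2 * h)) / 2)) 0 ^ 2) =
      h / 24 * u ^ 4 - 11 / 960 * u ^ 5 := by
    intro u hu
    rw [Set.uIcc_of_le (by linarith)] at hu
    have h1 : ∀ w : ℝ, max (w + (1 - h) - (1 - h) - (h - (u + (1 - 2 * h) - (1 - 2 * h)) / 2)) 0 ^ 2
        * ((u + (1 - 2 * h) - (1 - 2 * h)) * (w + (1 - h) - (1 - h)) -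
          max (w + (1 - h) - (1 - h) - (h - (u + (1 - 2 * h) - (1 - 2 * h)) / 2)) 0 ^ 2) =
        (fun s : ℝ => u * s ^ 3 + u * (h - u / 2) * s ^ 2 - s ^ 4)
          (max (w - (h - u / 2)) 0) := by
      intro w
      simp only [add_sub_cancel_right]
      rcases le_total (w - (h - u / 2)) 0 with hw | hw
      · rw [max_eq_right hw]; ring
      · rw [max_eq_left hw]; ring
    simp_rw [h1]
    rw [intervalIntegral_max_sub (g := fun s : ℝ => u * s ^ 3 + u * (h - u / 2) * s ^ 2 - s ^ 4)
      (by fun_prop) (by simp) (by linarith [hu.2]) hh, max_eq_left (by linarith [hu.1]),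
      intervalIntegral.integral_sub (Continuous.intervalIntegrable (by fun_prop) _ _)
        (Continuous.intervalIntegrable (by fun_prop) _ _),
      intervalIntegral.integral_add (Continuous.intervalIntegrable (by fun_prop) _ _)
        (Continuous.intervalIntegrable (by fun_prop) _ _),
      intervalIntegral.integral_const_mul, intervalIntegral.integral_const_mul,
      integral_pow, integral_pow, integral_pow]
    norm_num
    ring
  rw [intervalIntegral.integral_congr hinner,
    intervalIntegral.integral_sub (Continuous.intervalIntegrable (by fun_prop) _ _)
        (Continuous.intervalIntegrable (by fun_prop) _ _),
    intervalIntegral.integral_const_mul, intervalIntegral.integral_const_mul,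
    integral_pow, integral_pow]
  norm_num
  ring

theorem setIntegral_sq_add_sq {S T : Set (ℝ × ℝ)} {h : ℝ} (h1 : h ≤ 1 / 2)
    (hT : MeasurableSet T) (hST : AEDisjoint volume S T) (hU : S ∪ T = cornerRect h)
    (hS : S ⊆ cornerRect h) (hT' : T ⊆ cornerRect h) {B : ℝ × ℝ → ℝ} (hB : Continuous B)
    (hTB : ∀ y ∈ cornerRect h, lowerArea T y = B y) :
    ∫ y in Set.Icc (0 : ℝ) 1 ×ˢ Set.Icc (0 : ℝ) 1, (lowerArea S y ^ 2 + lowerArea T y ^ 2) =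
      (∫ y in cornerRect h, ((y.1 - (1 - 2 * h)) * (y.2 - (1 - h))) ^ 2) -
        2 * ∫ y in cornerRect h, B y * ((y.1 - (1 - 2 * h)) * (y.2 - (1 - h)) - B y) := by
  have hsub : cornerRect h ⊆ Set.Icc (0 : ℝ) 1 ×ˢ Set.Icc (0 : ℝ) 1 :=
    Set.prod_mono (Set.Icc_subset_Icc_left (by linarith)) (Set.Icc_subset_Icc_left (by linarith))
  have hint : ∀ {f : ℝ × ℝ → ℝ}, Continuous f → IntegrableOn f (cornerRect h) := fun hf =>
    hf.continuousOn.integrableOn_compact (isCompact_Icc.prod isCompact_Icc)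
  rw [setIntegral_eq_of_subset_of_forall_sdiff_eq_zero
    (measurableSet_Icc.prod measurableSet_Icc) hsub, ← integral_const_mul, ← integral_sub
    (hint (by fun_prop)) (hint (by fun_prop))]
  · refine setIntegral_congr_fun (measurableSet_cornerRect h) fun y hy => ?_
    have := lowerArea_add_lowerArea hT hST hU y
    rw [lowerArea_cornerRect hy, hTB y hy] at this
    rw [hTB y hy, ← this]
    ring
  · rintro y ⟨⟨h2, h3⟩, hy⟩
    have hy1 : y ≤ 1 := ⟨h2.2, h3.2⟩
    rw [lowerArea_eq_zero hS hy1 hy, lowerArea_eq_zero hT' hy1 hy]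
    norm_num

theorem setIntegral_squares_lt_setIntegral_triangles {h : ℝ} (h0 : 0 < h) (h1 : h ≤ 1 / 2) :
    ∫ y in Set.Icc (0 : ℝ) 1 ×ˢ Set.Icc (0 : ℝ) 1,
        (lowerArea (leftSquare h) y ^ 2 + lowerArea (rightSquare h) y ^ 2) <
      ∫ y in Set.Icc (0 : ℝ) 1 ×ˢ Set.Icc (0 : ℝ) 1,
        (lowerArea (lowerTriangle h) y ^ 2 + lowerArea (upperTriangle h) y ^ 2) := by
  have hsq := leftSquare_union_rightSquare h0.le
  have htr := lowerTriangle_union_upperTriangle h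
  rw [setIntegral_sq_add_sq h1 (measurableSet_rightSquare h) (aedisjoint_leftSquare_rightSquare h)
      hsq (hsq ▸ Set.subset_union_left) (hsq ▸ Set.subset_union_right) (by fun_prop)
      fun y hy => lowerArea_rightSquare hy,
    setIntegral_sq_add_sq h1 (measurableSet_upperTriangle h)
      (aedisjoint_lowerTriangle_upperTriangle h)
      htr (htr ▸ Set.subset_union_left) (htr ▸ Set.subset_union_right) (by fun_prop)
      fun y hy => lowerArea_upperTriangle hy,
    setIntegral_rightSquare_term h0.le, setIntegral_upperTriangle_term h0.le]
  have := pow_pos h0 6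
  linarith

theorem volume_eq_of_lowerArea_eq {S T : Set (ℝ × ℝ)} {h : ℝ} (hS : S ⊆ cornerRect h)
    (hT : T ⊆ cornerRect h) (hST : lowerArea S 1 = lowerArea T 1) : volume S = volume T := by
  have hfull : ∀ X ⊆ cornerRect h, X ∩ Set.Iic 1 = X := fun X hX =>
    Set.inter_eq_left.2 fun z hz => ⟨(hX hz).1.2, (hX hz).2.2⟩
  rw [lowerArea, lowerArea, hfull S hS, hfull T hT] at hST
  exact (ENNReal.toReal_eq_toReal_iff'
    (ne_top_of_le_ne_top (volume_cornerRect_ne_top h) (measure_mono hS))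
    (ne_top_of_le_ne_top (volume_cornerRect_ne_top h) (measure_mono hT))).1 hST

theorem lowerArea_upperTriangle_one {h : ℝ} (hh : 0 ≤ h) :
    lowerArea (upperTriangle h) 1 = lowerArea (rightSquare h) 1 := by
  have h1 : (1 : ℝ × ℝ) ∈ cornerRect h :=
    ⟨⟨by simp [hh], le_rfl⟩, ⟨by simp [hh], le_rfl⟩⟩
  rw [lowerArea_upperTriangle h1, lowerArea_rightSquare h1]
  simp only [Prod.fst_one, Prod.snd_one]
  rw [max_eq_left (by linarith), max_eq_left (by linarith)]
  ring

theorem volume_upperTriangle {h : ℝ} (hh : 0 ≤ h) :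
    volume (upperTriangle h) = volume (rightSquare h) :=
  volume_eq_of_lowerArea_eq Set.inter_subset_left
    (leftSquare_union_rightSquare hh ▸ Set.subset_union_right) (lowerArea_upperTriangle_one hh)

theorem lowerArea_triangles {h : ℝ} (hh : 0 ≤ h) (y : ℝ × ℝ) :
    lowerArea (lowerTriangle h) y + lowerArea (upperTriangle h) y =
      lowerArea (leftSquare h) y + lowerArea (rightSquare h) y := by
  rw [lowerArea_add_lowerArea (measurableSet_upperTriangle h)
    (aedisjoint_lowerTriangle_upperTriangle h) (lowerTriangle_union_upperTriangle h),
    lowerArea_add_lowerArea (measurableSet_rightSquare h)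
    (aedisjoint_leftSquare_rightSquare h) (leftSquare_union_rightSquare hh)]

theorem volume_lowerTriangle {h : ℝ} (hh : 0 ≤ h) :
    volume (lowerTriangle h) = volume (leftSquare h) := by
  refine volume_eq_of_lowerArea_eq Set.inter_subset_left
    (leftSquare_union_rightSquare hh ▸ Set.subset_union_left) ?_
  linarith [lowerArea_upperTriangle_one hh, lowerArea_triangles hh 1]

/-- Splitting off the first two coordinates of a vector. -/
def splitPlane (n : ℕ) : (Fin (n + 2) → ℝ) ≃ᵐ (ℝ × ℝ) × (Fin n → ℝ) :=
  (MeasurableEquiv.piFinSuccAbove (fun _ => ℝ) 0).trans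
    (((MeasurableEquiv.refl ℝ).prodCongr (MeasurableEquiv.piFinSuccAbove (fun _ => ℝ) 0)).trans
      MeasurableEquiv.prodAssoc.symm)

theorem splitPlane_apply {n : ℕ} (x : Fin (n + 2) → ℝ) :
    splitPlane n x = ((x 0, x 1), fun k => x k.succ.succ) := rfl

theorem volume_preserving_splitPlane (n : ℕ) : MeasurePreserving (splitPlane n) volume volume :=
  (volume_preserving_prodAssoc.symm).comp
    (((MeasurePreserving.id volume).prod
      (volume_preserving_piFinSuccAbove (fun _ : Fin (n + 1) => ℝ) 0)).comp
        (volume_preserving_piFinSuccAbove (fun _ : Fin (n + 2) => ℝ) 0))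

theorem splitPlane_le_iff {n : ℕ} {x y : Fin (n + 2) → ℝ} :
    splitPlane n x ≤ splitPlane n y ↔ x ≤ y := by
  simp only [splitPlane_apply, Prod.mk_le_mk, Pi.le_def, Fin.forall_fin_succ (n := n + 1),
    Fin.forall_fin_succ (n := n), and_assoc]
  rfl

/-- The points of `ℝ^(n+2)` whose first two coordinates form a point of `S` and whose other
coordinates lie in `[1 - h, 1]`. -/
def prism (n : ℕ) (h : ℝ) (S : Set (ℝ × ℝ)) : Set (Fin (n + 2) → ℝ) :=
  splitPlane n ⁻¹' (S ×ˢ Set.Icc (fun _ => 1 - h) (1 : Fin n → ℝ))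

theorem measurableSet_prism {n : ℕ} {h : ℝ} {S : Set (ℝ × ℝ)} (hS : MeasurableSet S) :
    MeasurableSet (prism n h S) :=
  (splitPlane n).measurable (hS.prod measurableSet_Icc)

theorem prism_union (n : ℕ) (h : ℝ) (S T : Set (ℝ × ℝ)) :
    prism n h S ∪ prism n h T = prism n h (S ∪ T) := by
  rw [prism, prism, prism, ← Set.preimage_union, Set.union_prod]

theorem convex_prism {n : ℕ} {h : ℝ} {S : Set (ℝ × ℝ)} (hS : Convex ℝ S) :
    Convex ℝ (prism n h S) :=
  (hS.prod (convex_Icc _ _)).is_linear_preimage (f := splitPlane n)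
    { map_add := fun _ _ => rfl, map_smul := fun _ _ => rfl }

theorem volume_splitPlane_preimage {n : ℕ} {S : Set (ℝ × ℝ)} {Q : Set (Fin n → ℝ)} :
    volume (splitPlane n ⁻¹' (S ×ˢ Q)) = volume S * volume Q := by
  rw [(volume_preserving_splitPlane n).measure_preimage_equiv, Measure.volume_eq_prod,
    Measure.prod_prod]

theorem volume_prism_congr {n : ℕ} {h : ℝ} {S T : Set (ℝ × ℝ)} (hST : volume S = volume T) :
    volume (prism n h S) = volume (prism n h T) := by
  rw [prism, prism, volume_splitPlane_preimage, volume_splitPlane_preimage, hST]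

theorem aedisjoint_prism {n : ℕ} {h : ℝ} {S T : Set (ℝ × ℝ)} (hST : AEDisjoint volume S T) :
    AEDisjoint volume (prism n h S) (prism n h T) := by
  rw [AEDisjoint, prism, prism, ← Set.preimage_inter, Set.prod_inter_prod,
    volume_splitPlane_preimage, hST, zero_mul]

theorem vol_prism_inter_Iic {n : ℕ} {h : ℝ} {S : Set (ℝ × ℝ)} (x : Fin (n + 2) → ℝ) :
    vol (prism n h S ∩ Set.Iic x) = lowerArea S (splitPlane n x).1 *
      vol (Set.Icc (fun _ => 1 - h) (1 : Fin n → ℝ) ∩ Set.Iic (splitPlane n x).2) := by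
  have : prism n h S ∩ Set.Iic x = splitPlane n ⁻¹' ((S ∩ Set.Iic (splitPlane n x).1) ×ˢ
      (Set.Icc (fun _ => 1 - h) (1 : Fin n → ℝ) ∩ Set.Iic (splitPlane n x).2)) := by
    rw [← Set.prod_inter_prod, Set.Iic_prod_Iic, Set.preimage_inter, prism]
    congr 1
    ext y
    exact splitPlane_le_iff.symm
  rw [this, vol, volume_splitPlane_preimage, ENNReal.toReal_mul]
  rfl

theorem Icc_eq_splitPlane_preimage (n : ℕ) : Set.Icc (0 : Fin (n + 2) → ℝ) 1 =
    splitPlane n ⁻¹' ((Set.Icc (0 : ℝ) 1 ×ˢ Set.Icc (0 : ℝ) 1) ×ˢ Set.Icc (0 : Fin n → ℝ) 1) := by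
  rw [Set.Icc_prod_Icc, Set.Icc_prod_Icc]
  ext x
  exact and_congr (splitPlane_le_iff (x := 0)).symm (splitPlane_le_iff (y := 1)).symm

theorem setIntegral_sq_prism (n : ℕ) (h v : ℝ) (S T : Set (ℝ × ℝ)) :
    ∫ x in Set.Icc (0 : Fin (n + 2) → ℝ) 1, ((vol (prism n h S ∩ Set.Iic x) / v) ^ 2 +
        (vol (prism n h T ∩ Set.Iic x) / v) ^ 2) =
      (∫ y in Set.Icc (0 : ℝ) 1 ×ˢ Set.Icc (0 : ℝ) 1, (lowerArea S y ^ 2 + lowerArea T y ^ 2)) *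
        ∫ z in Set.Icc (0 : Fin n → ℝ) 1,
          (vol (Set.Icc (fun _ => 1 - h) (1 : Fin n → ℝ) ∩ Set.Iic z) / v) ^ 2 := by
  rw [Icc_eq_splitPlane_preimage, ← setIntegral_prod_mul, ← Measure.volume_eq_prod,
    ← (volume_preserving_splitPlane n).setIntegral_preimage_emb
      (splitPlane n).measurableEmbedding]
  simp_rw [vol_prism_inter_Iic]
  congr 1
  ext x
  ring

theorem setIntegral_tail_pos (n : ℕ) {h v : ℝ} (h0 : 0 < h) (h1 : h ≤ 1) (hv : v ≠ 0) :
    0 < ∫ z in Set.Icc (0 : Fin n → ℝ) 1,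
      (vol (Set.Icc (fun _ => 1 - h) (1 : Fin n → ℝ) ∩ Set.Iic z) / v) ^ 2 := by
  have hfin : volume (Set.Icc (fun _ => 1 - h) (1 : Fin n → ℝ)) ≠ ⊤ :=
    isCompact_Icc.measure_lt_top.ne
  rw [setIntegral_pos_iff_support_of_nonneg_ae
    (Filter.Eventually.of_forall fun z => sq_nonneg _)]
  · refine lt_of_lt_of_le ?_ (measure_mono
      (s := Set.pi Set.univ fun _ : Fin n => Set.Ioc (1 - h) 1) ?_)
    · rw [Real.volume_pi_Ioc]
      simpa using ENNReal.pow_pos (ENNReal.ofReal_pos.2 h0) n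
    · intro z hz
      have hz' : ∀ k, 1 - h < z k ∧ z k ≤ 1 := fun k => hz k trivial
      refine ⟨?_, fun k => ?_, fun k => (hz' k).2⟩
      · refine pow_ne_zero 2 (div_ne_zero (ENNReal.toReal_pos ?_
          (ne_top_of_le_ne_top hfin (measure_mono Set.inter_subset_left))).ne' hv)
        have : Set.Icc (fun _ => 1 - h) (1 : Fin n → ℝ) ∩ Set.Iic z =
            Set.Icc (fun _ => 1 - h) z := by
          ext w
          exact ⟨fun hw => ⟨hw.1.1, hw.2⟩,
            fun hw => ⟨⟨hw.1, hw.2.trans fun k => (hz' k).2⟩, hw.2⟩⟩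
        rw [this, Real.volume_Icc_pi]
        exact Finset.prod_ne_zero_iff.2 fun k _ => by simpa using (hz' k).1
      · simp only [Pi.zero_apply]
        linarith [(hz' k).1]
  · refine Measure.integrableOn_of_bounded (M := (vol (Set.Icc (fun _ => 1 - h)
      (1 : Fin n → ℝ)) / v) ^ 2) isCompact_Icc.measure_lt_top.ne
      (((measurable_vol_inter_Iic measurableSet_Icc).div_const v).pow_const
        2).aestronglyMeasurable (Filter.Eventually.of_forall fun z => ?_)
    rw [Real.norm_of_nonneg (sq_nonneg _), div_pow, div_pow]
    have : vol (Set.Icc (fun _ => 1 - h) (1 : Fin n → ℝ) ∩ Set.Iic z) ≤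
        vol (Set.Icc (fun _ => 1 - h) (1 : Fin n → ℝ)) :=
      ENNReal.toReal_mono hfin (measure_mono Set.inter_subset_left)
    have h2 : 0 ≤ vol (Set.Icc (fun _ => 1 - h) (1 : Fin n → ℝ) ∩ Set.Iic z) :=
      ENNReal.toReal_nonneg
    gcongr

theorem measurableSet_jitteredCube {d : ℕ} (m : ℕ) (j : Fin d → Fin m) :
    MeasurableSet (jitteredCube m j) := measurableSet_Icc

theorem convex_jitteredCube {d : ℕ} (m : ℕ) (j : Fin d → Fin m) :
    Convex ℝ (jitteredCube m j) := convex_Icc _ _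

theorem volume_jitteredCube {d : ℕ} (m : ℕ) (j : Fin d → Fin m) :
    volume (jitteredCube m j) = ENNReal.ofReal (1 / m) ^ d := by
  rw [jitteredCube, Real.volume_Icc_pi]
  simp [← sub_div]

theorem aedisjoint_jitteredCube {d m : ℕ} {i j : Fin d → Fin m} (hij : i ≠ j) :
    AEDisjoint volume (jitteredCube m i) (jitteredCube m j) := by
  obtain ⟨k, hk⟩ := Function.ne_iff.1 hij
  wlog hlt : i k < j k generalizing i j
  · exact (this hij.symm hk.symm (lt_of_le_of_ne (not_lt.1 hlt) hk.symm)).symm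
  refine measure_mono_null (t := {x : Fin d → ℝ | x k = (j k : ℝ) / m}) ?_
    (Measure.pi_hyperplane _ k _)
  rintro x ⟨hi, hj⟩
  refine le_antisymm ((hi.2 k).trans ?_) (hj.1 k)
  have : ((i k : ℕ) : ℝ) + 1 ≤ (j k : ℕ) := by exact_mod_cast hlt
  simp only
  gcongr

theorem iUnion_jitteredCube {d m : ℕ} (hm : 0 < m) :
    ⋃ j : Fin d → Fin m, jitteredCube m j = Set.Icc (0 : Fin d → ℝ) 1 := by
  have hm' : (0 : ℝ) < m := Nat.cast_pos.2 hm
  refine Set.Subset.antisymm (Set.iUnion_subset fun j x hx => ⟨fun k => ?_, fun k => ?_⟩) ?_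
  · exact (by positivity : (0 : ℝ) ≤ (j k : ℝ) / m).trans (hx.1 k)
  · refine (hx.2 k).trans ?_
    have : ((j k : ℕ) : ℝ) + 1 ≤ m := by exact_mod_cast (j k).2
    exact div_le_one_of_le₀ this hm'.le
  · intro x hx
    refine Set.mem_iUnion.2 ⟨fun k => ⟨min ⌊x k * m⌋₊ (m - 1), by omega⟩, fun k => ?_, fun k => ?_⟩
    · have h0 : 0 ≤ x k * m := mul_nonneg (hx.1 k) hm'.le
      rw [div_le_iff₀ hm']
      exact (Nat.cast_le.2 (min_le_left _ _)).trans (Nat.floor_le h0)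
    · rw [le_div_iff₀ hm']
      rcases le_total ⌊x k * m⌋₊ (m - 1) with h | h
      · simp only [min_eq_left h]
        exact (Nat.lt_floor_add_one _).le
      · simp only [min_eq_right h]
        rw [Nat.cast_sub hm]
        have := mul_le_mul_of_nonneg_right (hx.2 k) hm'.le
        simp only [Pi.one_apply] at this
        push_cast
        linarith

theorem isPartition_of_aedisjoint {d : ℕ} {ι : Type} [Fintype ι] {K : Set (Fin d → ℝ)}
    {Ω : ι → Set (Fin d → ℝ)} (hm : ∀ i, MeasurableSet (Ω i)) (hpos : ∀ i, 0 < volume (Ω i))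
    (hU : ⋃ i, Ω i = K) (hdisj : Pairwise (Function.onFun (AEDisjoint volume) Ω)) :
    IsPartition K Ω where
  measurableSet := hm
  vol_pos := hpos
  iUnion_eq := hU
  disjoint_interiors _ _ hij :=
    (isOpen_interior.inter isOpen_interior).eq_empty_of_measure_zero (measure_mono_null
      (Set.inter_subset_inter interior_subset interior_subset) (hdisj hij))

/-- Repartitioning the union of two cells of a partition. -/
theorem isPartition_update_update {d : ℕ} {ι : Type} [Fintype ι] [DecidableEq ι]
    {K : Set (Fin d → ℝ)} {Ω : ι → Set (Fin d → ℝ)} (hm : ∀ i, MeasurableSet (Ω i))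
    (hpos : ∀ i, 0 < volume (Ω i)) (hU : ⋃ i, Ω i = K)
    (hdisj : Pairwise (Function.onFun (AEDisjoint volume) Ω)) {a b : ι} (hab : a ≠ b)
    {A B : Set (Fin d → ℝ)} (hA : MeasurableSet A) (hB : MeasurableSet B)
    (hApos : 0 < volume A) (hBpos : 0 < volume B) (hAB : AEDisjoint volume A B)
    (hunion : A ∪ B = Ω a ∪ Ω b) :
    IsPartition K (Function.update (Function.update Ω a A) b B) := by
  have ha : Function.update (Function.update Ω a A) b B a = A := by simp [hab]
  have hb : Function.update (Function.update Ω a A) b B b = B := by simp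
  have hc : ∀ i, i ≠ a → i ≠ b → Function.update (Function.update Ω a A) b B i = Ω i :=
    fun i hia hib => by simp [hia, hib]
  generalize Function.update (Function.update Ω a A) b B = Ψ at ha hb hc
  have hcases : ∀ p : Set (Fin d → ℝ) → Prop, p A → p B → (∀ i, p (Ω i)) → ∀ i, p (Ψ i) := by
    intro p hpA hpB hp i
    rcases eq_or_ne i a with rfl | hia
    · rwa [ha]
    · rcases eq_or_ne i b with rfl | hib
      · rwa [hb]
      · rw [hc i hia hib]
        exact hp i
  refine isPartition_of_aedisjoint (hcases (MeasurableSet ·) hA hB hm)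
    (hcases (0 < volume ·) hApos hBpos hpos) ?_ ?_
  · have hAK : A ∪ B ⊆ K := by
      rw [hunion, ← hU]
      exact Set.union_subset (Set.subset_iUnion Ω a) (Set.subset_iUnion Ω b)
    refine Set.Subset.antisymm (Set.iUnion_subset (hcases (· ⊆ K)
      (Set.subset_union_left.trans hAK) (Set.subset_union_right.trans hAK)
      fun i => hU ▸ Set.subset_iUnion Ω i)) ?_
    have hABΨ : Ω a ∪ Ω b ⊆ ⋃ i, Ψ i := by
      rw [← hunion, ← ha, ← hb]
      exact Set.union_subset (Set.subset_iUnion Ψ a) (Set.subset_iUnion Ψ b)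
    rw [← hU]
    refine Set.iUnion_subset fun i => ?_
    rcases eq_or_ne i a with rfl | hia
    · exact Set.subset_union_left.trans hABΨ
    · rcases eq_or_ne i b with rfl | hib
      · exact Set.subset_union_right.trans hABΨ
      · rw [← hc i hia hib]
        exact Set.subset_iUnion Ψ i
  · have hnew : ∀ X ⊆ A ∪ B, ∀ i, i ≠ a → i ≠ b → AEDisjoint volume X (Ψ i) := by
      intro X hX i hia hib
      rw [hc i hia hib]
      exact (AEDisjoint.union_left (hdisj hia.symm) (hdisj hib.symm)).mono
        (hX.trans hunion.subset) subset_rfl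
    have hAX : A ⊆ A ∪ B := Set.subset_union_left
    have hBX : B ⊆ A ∪ B := Set.subset_union_right
    intro i j hij
    change AEDisjoint volume (Ψ i) (Ψ j)
    rcases eq_or_ne i a with rfl | hia
    · rw [ha]
      rcases eq_or_ne j b with rfl | hjb
      · rwa [hb]
      · exact hnew A hAX j hij.symm hjb
    rcases eq_or_ne i b with rfl | hib
    · rw [hb]
      rcases eq_or_ne j a with rfl | hja
      · rw [ha]
        exact hAB.symm
      · exact hnew B hBX j hja hij.symm
    rcases eq_or_ne j a with rfl | hja
    · rw [ha]
      exact (hnew A hAX i hia hib).symm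
    rcases eq_or_ne j b with rfl | hjb
    · rw [hb]
      exact (hnew B hBX i hia hib).symm
    rw [hc i hia hib, hc j hja hjb]
    exact hdisj hij

theorem jitteredCube_cons_eq_prism {n m : ℕ} (hm : 0 < m) (i : Fin m) :
    jitteredCube m (Fin.cons i fun _ => ⟨m - 1, by omega⟩ : Fin (n + 2) → Fin m) =
      prism n (1 / (m : ℝ)) (Set.Icc ((i : ℝ) / m) (((i : ℝ) + 1) / m) ×ˢ
        Set.Icc (1 - 1 / (m : ℝ)) 1) := by
  have hm' : (m : ℝ) ≠ 0 := Nat.cast_ne_zero.2 hm.ne'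
  have h1 : ((m - 1 : ℕ) : ℝ) / m = 1 - 1 / m := by
    rw [Nat.cast_sub hm, sub_div, div_self hm', Nat.cast_one]
  have h2 : (((m - 1 : ℕ) : ℝ) + 1) / m = 1 := by
    rw [Nat.cast_sub hm, Nat.cast_one, sub_add_cancel, div_self hm']
  rw [prism, Set.Icc_prod_Icc, Set.Icc_prod_Icc]
  have hIcc : ∀ lo hi : Fin (n + 2) → ℝ, Set.Icc lo hi =
      splitPlane n ⁻¹' Set.Icc (splitPlane n lo) (splitPlane n hi) := fun lo hi => by
    ext x
    exact and_congr splitPlane_le_iff.symm splitPlane_le_iff.symm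
  rw [jitteredCube, hIcc]
  congr 2
  · exact Prod.ext (Prod.ext rfl h1) (funext fun _ => h1)
  · exact Prod.ext (Prod.ext rfl h2) (funext fun _ => h2)

/-- Jittered sampling is not optimal: for `d, m ≥ 2`, the stratified sample from the
jittered partition of `[0,1]^d` into the `m^d` congruent axis-aligned cubes of side
`1/m` does not minimize the mean squared L2-discrepancy among stratified samples from
convex equivolume partitions of `[0,1]^d` into `m^d` sets. -/
theorem jittered_sampling_not_optimal (d m : ℕ) (hd : 2 ≤ d) (hm : 2 ≤ m) :
    ∃ Ω' : (Fin d → Fin m) → Set (Fin d → ℝ),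
      IsPartition (Set.Icc (0 : Fin d → ℝ) 1) Ω' ∧
      (∀ j, Convex ℝ (Ω' j)) ∧
      IsEquivolume Ω' ∧
      meanL2sq (Set.Icc (0 : Fin d → ℝ) 1) Ω' <
        meanL2sq (Set.Icc (0 : Fin d → ℝ) 1) (jitteredCube m) := by
  obtain ⟨n, rfl⟩ := Nat.exists_eq_add_of_le' hd
  have hm0 : (0 : ℝ) < m := by positivity
  set h : ℝ := 1 / (m : ℝ) with hh
  have h0 : 0 < h := by positivity
  have h1 : h ≤ 1 / 2 := one_div_le_one_div_of_le two_pos (by exact_mod_cast hm)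
  have hmh : (m : ℝ) * h = 1 := mul_one_div_cancel hm0.ne'
  set a : Fin (n + 2) → Fin m := Fin.cons ⟨m - 2, by omega⟩ fun _ => ⟨m - 1, by omega⟩ with ha
  set b : Fin (n + 2) → Fin m := Fin.cons ⟨m - 1, by omega⟩ fun _ => ⟨m - 1, by omega⟩ with hb
  have hab : a ≠ b := fun e => by
    have := congrArg Fin.val (congrFun e 0)
    simp only [ha, hb, Fin.cons_zero] at this
    omega
  have hca : jitteredCube m a = prism n h (leftSquare h) := by
    rw [ha, jitteredCube_cons_eq_prism (by omega), ← hh, leftSquare, Nat.cast_sub hm]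
    congr 3 <;> rw [div_eq_iff hm0.ne'] <;> push_cast <;> linarith
  have hcb : jitteredCube m b = prism n h (rightSquare h) := by
    rw [hb, jitteredCube_cons_eq_prism (by omega), ← hh, rightSquare,
      Nat.cast_sub (by omega : 1 ≤ m)]
    congr 3 <;> rw [div_eq_iff hm0.ne'] <;> push_cast <;> linarith
  have hvA : volume (prism n h (lowerTriangle h)) = ENNReal.ofReal h ^ (n + 2) := by
    rw [volume_prism_congr (volume_lowerTriangle h0.le), ← hca, volume_jitteredCube]
  have hvB : volume (prism n h (upperTriangle h)) = ENNReal.ofReal h ^ (n + 2) := by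
    rw [volume_prism_congr (volume_upperTriangle h0.le), ← hcb, volume_jitteredCube]
  have hpos : 0 < ENNReal.ofReal h ^ (n + 2) := ENNReal.pow_pos (ENNReal.ofReal_pos.2 h0) _
  have hfin : ENNReal.ofReal h ^ (n + 2) ≠ ⊤ := ENNReal.pow_ne_top ENNReal.ofReal_ne_top
  have hpart := isPartition_update_update (measurableSet_jitteredCube m)
    (fun i => (volume_jitteredCube m i).symm ▸ hpos) (iUnion_jitteredCube (by omega))
    (fun _ _ => aedisjoint_jitteredCube) hab
    (measurableSet_prism (n := n) (h := h) (measurableSet_lowerTriangle h))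
    (measurableSet_prism (measurableSet_upperTriangle h)) (hvA ▸ hpos) (hvB ▸ hpos)
    (aedisjoint_prism (aedisjoint_lowerTriangle_upperTriangle h))
    (by rw [hca, hcb, prism_union, prism_union, lowerTriangle_union_upperTriangle,
      leftSquare_union_rightSquare h0.le])
  set Ω' := Function.update (Function.update (jitteredCube m) a (prism n h (lowerTriangle h))) b
    (prism n h (upperTriangle h))
  have ha' : Ω' a = prism n h (lowerTriangle h) := by simp [Ω', hab]
  have hb' : Ω' b = prism n h (upperTriangle h) := by simp [Ω']
  have hc' : ∀ i, i ≠ a → i ≠ b → Ω' i = jitteredCube m i :=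
    fun i hia hib => by simp [Ω', hia, hib]
  have hvol : ∀ i, volume (Ω' i) = ENNReal.ofReal h ^ (n + 2) := by
    intro i
    rcases eq_or_ne i a with rfl | hia
    · rw [ha', hvA]
    rcases eq_or_ne i b with rfl | hib
    · rw [hb', hvB]
    rw [hc' i hia hib, volume_jitteredCube]
  refine ⟨Ω', hpart, fun i => ?_, fun i j => (hvol i).trans (hvol j).symm, ?_⟩
  · rcases eq_or_ne i a with rfl | hia
    · exact ha' ▸ convex_prism (convex_lowerTriangle h)
    rcases eq_or_ne i b with rfl | hib
    · exact hb' ▸ convex_prism (convex_upperTriangle h)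
    exact hc' i hia hib ▸ convex_jitteredCube m i
  have hq : ∀ i x, qfun (jitteredCube m) i x =
      vol (jitteredCube m i ∩ Set.Iic x) / (ENNReal.ofReal h ^ (n + 2)).toReal := fun i x => by
    rw [qfun, vol, vol, volume_jitteredCube]
  have hq' : ∀ i x, qfun Ω' i x =
      vol (Ω' i ∩ Set.Iic x) / (ENNReal.ofReal h ^ (n + 2)).toReal := fun i x => by
    rw [qfun, vol, vol, hvol]
  refine meanL2sq_lt_of_two_cells measurableSet_Icc ?_ isCompact_Icc.measure_lt_top.ne
    (fun i => (volume_jitteredCube m i).symm ▸ hpos.ne')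
    (fun i => (volume_jitteredCube m i).symm ▸ hfin) (measurableSet_jitteredCube m)
    (fun i => (hpart.vol_pos i).ne') (fun i => (hvol i).symm ▸ hfin) hpart.measurableSet hab hc'
    (fun x => ?_) ?_
  · simp [Real.volume_Icc_pi]
  · rw [hq, hq, hq', hq', ha', hb', hca, hcb, ← add_div, ← add_div]
    simp only [vol_prism_inter_Iic, ← add_mul, lowerArea_triangles h0.le]
  · simp only [hq, hq', ha', hb', hca, hcb, setIntegral_sq_prism]
    exact mul_lt_mul_of_pos_right (setIntegral_squares_lt_setIntegral_triangles h0 h1)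
      (setIntegral_tail_pos n h0 (by linarith) (ENNReal.toReal_pos hpos.ne' hfin).ne')

end StratifiedSampling
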